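/- arXiv:1410.1698 — 2 statements merged into one kernel-verified Lean document; each statement's English description precedes it below -/
import Mathlib

section
/- Let Γ ⊂ ℝ² be a two-dimensional lattice polygon with exactly 3 lattice points on its boundary ∂Γ (so Γ is a triangle whose only boundary lattice points are its three vertices), not unimodularly equivalent to Σ, and such that Γ^{(1)} is two-dimensional. Let v₁ be a vertex of Γ and let Γ' be the convex hull of (Γ ∩ ℤ²) \ {v₁}. Then Γ' is a two-dimensional lattice polygon with at least 4 lattice points on its boundary ∂Γ'. -/
open Pointwise

noncomputable section

def toR (p : ℤ × ℤ) : ℝ × ℝ := ((p.1 : ℝ), (p.2 : ℝ))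

def IsLatticePolygon (P : Set (ℝ × ℝ)) : Prop :=
  ∃ S : Finset (ℤ × ℤ), P = convexHull ℝ (toR '' ↑S)

def latticePts (A : Set (ℝ × ℝ)) : Set (ℤ × ℤ) := {p | toR p ∈ A}

def interiorHull (P : Set (ℝ × ℝ)) : Set (ℝ × ℝ) :=
  convexHull ℝ (toR '' latticePts (interior P))

/-- Affine map `x ↦ M x + v` on `ℝ²` induced by `M ∈ Mat₂(ℤ)`, `v ∈ ℤ²`. -/
def unimodMap (M : Matrix (Fin 2) (Fin 2) ℤ) (v : ℤ × ℤ) (x : ℝ × ℝ) : ℝ × ℝ :=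
  ((M 0 0 : ℝ) * x.1 + (M 0 1 : ℝ) * x.2 + (v.1 : ℝ),
   (M 1 0 : ℝ) * x.1 + (M 1 1 : ℝ) * x.2 + (v.2 : ℝ))

def UnimodEquiv (P Q : Set (ℝ × ℝ)) : Prop :=
  ∃ (M : Matrix (Fin 2) (Fin 2) ℤ) (v : ℤ × ℤ), IsUnit M.det ∧ Q = unimodMap M v '' P

/-- The unimodular triangle `Σ = conv{(0,0),(1,0),(0,1)}`. -/
def SigmaTri : Set (ℝ × ℝ) :=
  convexHull ℝ {((0 : ℝ), (0 : ℝ)), ((1 : ℝ), (0 : ℝ)), ((0 : ℝ), (1 : ℝ))}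

/-- Twice the signed area of the triangle with vertices `a`, `b`, `p`. -/
def cross {R : Type*} [CommRing R] (a b p : R × R) : R :=
  (b.1 - a.1) * (p.2 - a.2) - (b.2 - a.2) * (p.1 - a.1)

theorem cross_toR (a b p : ℤ × ℤ) : cross (toR a) (toR b) (toR p) = (cross a b p : ℤ) := by
  simp [cross, toR]

theorem toR_injective : Function.Injective toR := by
  intro a b h
  simp only [toR, Prod.mk.injEq, Int.cast_inj] at h
  exact Prod.ext h.1 h.2

theorem finite_latticePts {A : Set (ℝ × ℝ)} (hA : Bornology.IsBounded A) :
    (latticePts A).Finite := by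
  obtain ⟨r, hr⟩ := hA.exists_norm_le
  refine (Set.finite_Icc ((-⌈r⌉, -⌈r⌉) : ℤ × ℤ) (⌈r⌉, ⌈r⌉)).subset fun p hp => ?_
  have h := hr _ hp
  rw [Prod.norm_def, sup_le_iff] at h
  simp only [toR, Real.norm_eq_abs, abs_le] at h
  have hc := Int.le_ceil r
  refine ⟨⟨?_, ?_⟩, ⟨?_, ?_⟩⟩ <;> simp only <;> rify <;> linarith [h.1.1, h.1.2, h.2.1, h.2.2]

theorem IsLatticePolygon.isCompact {P : Set (ℝ × ℝ)} (hP : IsLatticePolygon P) : IsCompact P := by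
  obtain ⟨S, rfl⟩ := hP
  exact (S.finite_toSet.image toR).isCompact_convexHull ℝ

theorem IsLatticePolygon.convex {P : Set (ℝ × ℝ)} (hP : IsLatticePolygon P) : Convex ℝ P := by
  obtain ⟨S, rfl⟩ := hP
  exact convex_convexHull ℝ _

theorem IsLatticePolygon.eq_convexHull_extremePoints {P : Set (ℝ × ℝ)} (hP : IsLatticePolygon P) :
    P = convexHull ℝ (toR '' latticePts (P.extremePoints ℝ)) := by
  have himage : toR '' latticePts (P.extremePoints ℝ) = P.extremePoints ℝ := by
    obtain ⟨S, rfl⟩ := hP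
    refine Set.Subset.antisymm (by rintro _ ⟨p, hp, rfl⟩; exact hp) fun x hx => ?_
    obtain ⟨p, -, rfl⟩ := extremePoints_convexHull_subset hx
    exact ⟨p, hx, rfl⟩
  have hfin : (latticePts (P.extremePoints ℝ)).Finite :=
    finite_latticePts (hP.isCompact.isBounded.subset extremePoints_subset)
  have hclosed := (hfin.image toR).isClosed_convexHull ℝ
  rw [himage] at hclosed ⊢
  conv_lhs => rw [← closure_convexHull_extremePoints hP.isCompact hP.convex]
  exact hclosed.closure_eq

theorem notMem_interior_of_mem_extremePoints {P : Set (ℝ × ℝ)} {x : ℝ × ℝ}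
    (hx : x ∈ P.extremePoints ℝ) : x ∉ interior P :=
  fun h => (disjoint_interior_extremePoints P).le_bot ⟨h, hx⟩

theorem extremePoints_subset_frontier {P : Set (ℝ × ℝ)} : P.extremePoints ℝ ⊆ frontier P :=
  fun _ hx => ⟨subset_closure hx.1, notMem_interior_of_mem_extremePoints hx⟩

theorem collinear_convexHull {s : Set (ℝ × ℝ)} :
    Collinear ℝ (convexHull ℝ s) ↔ Collinear ℝ s := by
  rw [Collinear, Collinear, ← direction_affineSpan, affineSpan_convexHull, direction_affineSpan]

theorem three_le_ncard_of_not_collinear {E : Set (ℤ × ℤ)} (hE : E.Finite)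
    (h : ¬ Collinear ℝ (toR '' E)) : 3 ≤ E.ncard := by
  by_contra! hlt
  apply h
  obtain h0 | h1 | h2 : E.ncard = 0 ∨ E.ncard = 1 ∨ E.ncard = 2 := by omega
  · rw [(Set.ncard_eq_zero hE).1 h0, Set.image_empty]
    exact collinear_empty ℝ _
  · obtain ⟨a, rfl⟩ := Set.ncard_eq_one.1 h1
    rw [Set.image_singleton]
    exact collinear_singleton ℝ _
  · obtain ⟨a, b, -, rfl⟩ := Set.ncard_eq_two.1 h2
    rw [Set.image_pair]
    exact collinear_pair ℝ _ _

/-- A two-dimensional lattice polygon with at most three boundary lattice points is a triangle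
whose boundary lattice points are its vertices. -/
theorem IsLatticePolygon.ncard_extremePoints_eq_three {P : Set (ℝ × ℝ)} (hP : IsLatticePolygon P)
    (hdim : ¬ Collinear ℝ P) (hb : (latticePts (frontier P)).ncard ≤ 3) :
    (latticePts (P.extremePoints ℝ)).ncard = 3 ∧
      latticePts (P.extremePoints ℝ) = latticePts (frontier P) := by
  have hfin : (latticePts (frontier P)).Finite :=
    finite_latticePts (hP.isCompact.isBounded.subset hP.isCompact.isClosed.frontier_subset)
  have hsub : latticePts (P.extremePoints ℝ) ⊆ latticePts (frontier P) :=
    fun p hp => extremePoints_subset_frontier hp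
  have h3 : 3 ≤ (latticePts (P.extremePoints ℝ)).ncard := by
    refine three_le_ncard_of_not_collinear (hfin.subset hsub) fun h => hdim ?_
    rw [hP.eq_convexHull_extremePoints]
    exact collinear_convexHull.2 h
  have hle := Set.ncard_le_ncard hsub hfin
  exact ⟨by omega, Set.eq_of_subset_of_ncard_le hsub (by omega) hfin⟩

theorem collinear_of_forall_cross_eq_zero {s : Set (ℝ × ℝ)} {a b : ℝ × ℝ} (hab : a ≠ b)
    (h : ∀ p ∈ s, cross a b p = 0) : Collinear ℝ s := by
  rw [collinear_iff_exists_forall_eq_smul_vadd]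
  have hd : (b.1 - a.1) ^ 2 + (b.2 - a.2) ^ 2 ≠ 0 := by
    intro h0
    apply hab
    ext
    · nlinarith [sq_nonneg (b.1 - a.1), sq_nonneg (b.2 - a.2)]
    · nlinarith [sq_nonneg (b.1 - a.1), sq_nonneg (b.2 - a.2)]
  refine ⟨a, b - a, fun p hp => ⟨((b.1 - a.1) * (p.1 - a.1) + (b.2 - a.2) * (p.2 - a.2)) /
    ((b.1 - a.1) ^ 2 + (b.2 - a.2) ^ 2), ?_⟩⟩
  have hc := h p hp
  simp only [cross] at hc
  ext
  · simp only [vadd_eq_add, Prod.fst_add, Prod.smul_fst, Prod.fst_sub, smul_eq_mul]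
    field_simp
    linear_combination (b.2 - a.2) * (-hc)
  · simp only [vadd_eq_add, Prod.snd_add, Prod.smul_snd, Prod.snd_sub, smul_eq_mul]
    field_simp
    linear_combination (b.1 - a.1) * hc

theorem cross_ne_zero_of_not_collinear {a b c : ℝ × ℝ} (hab : a ≠ b)
    (h : ¬ Collinear ℝ {a, b, c}) : cross a b c ≠ 0 := by
  intro h0
  refine h (collinear_of_forall_cross_eq_zero hab ?_)
  rintro p (rfl | rfl | rfl)
  · simp [cross]
  · simp only [cross]; ring
  · exact h0

theorem cross_combination (u v a b c : ℝ × ℝ) {x y z : ℝ} (h : x + y + z = 1) :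
    cross u v (x • a + y • b + z • c) = x * cross u v a + y * cross u v b + z * cross u v c := by
  simp only [cross, Prod.fst_add, Prod.snd_add, Prod.smul_fst, Prod.smul_snd, smul_eq_mul]
  linear_combination ((v.2 - u.2) * u.1 - (v.1 - u.1) * u.2) * (-h)

theorem mem_convexHull_triple {a b c p : ℝ × ℝ} : p ∈ convexHull ℝ {a, b, c} ↔
    ∃ x y z : ℝ, 0 ≤ x ∧ 0 ≤ y ∧ 0 ≤ z ∧ x + y + z = 1 ∧ p = x • a + y • b + z • c := by
  rw [convexHull_insert (Set.insert_nonempty _ _), convexHull_pair, mem_convexJoin]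
  constructor
  · rintro ⟨a', rfl, q, ⟨s, t, hs, ht, hst, rfl⟩, ⟨u, v, hu, hv, huv, rfl⟩⟩
    refine ⟨u, v * s, v * t, hu, by positivity, by positivity, ?_, ?_⟩
    · linear_combination huv + v * hst
    · module
  · rintro ⟨x, y, z, hx, hy, hz, h, rfl⟩
    refine ⟨a, rfl, ?_⟩
    rcases eq_or_lt_of_le (add_nonneg hy hz) with h0 | h0
    · obtain rfl : y = 0 := by linarith
      obtain rfl : z = 0 := by linarith
      refine ⟨b, left_mem_segment _ _ _, ?_⟩
      obtain rfl : x = 1 := by linarith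
      simpa using left_mem_segment ℝ a b
    · refine ⟨(y / (y + z)) • b + (z / (y + z)) • c,
        ⟨_, _, by positivity, by positivity, by field_simp, rfl⟩,
        ⟨x, y + z, hx, h0.le, by linarith, ?_⟩⟩
      rw [smul_add, smul_smul, smul_smul, mul_div_cancel₀ _ h0.ne', mul_div_cancel₀ _ h0.ne',
        add_assoc]

theorem exists_pos_of_mem_interior_convexHull_triple {a b c p : ℝ × ℝ}
    (hp : p ∈ interior (convexHull ℝ {a, b, c})) :
    ∃ x y z : ℝ, 0 < x ∧ 0 < y ∧ 0 < z ∧ x + y + z = 1 ∧ p = x • a + y • b + z • c := by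
  have hcont : ContinuousAt
      (fun t : ℝ => p + t • (p - (3⁻¹ : ℝ) • (a + b + c))) 0 := by fun_prop
  have hev : ∀ᶠ t : ℝ in nhds 0, p + t • (p - (3⁻¹ : ℝ) • (a + b + c)) ∈
      convexHull ℝ {a, b, c} :=
    hcont (by simpa using mem_interior_iff_mem_nhds.1 hp)
  obtain ⟨t, ht, ht0⟩ := ((hev.filter_mono nhdsWithin_le_nhds).and
    (self_mem_nhdsWithin (s := Set.Ioi (0 : ℝ)))).exists
  obtain ⟨x, y, z, hx, hy, hz, h, heq⟩ := mem_convexHull_triple.1 ht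
  have ht0 : 0 < t := ht0
  refine ⟨(x + t / 3) / (1 + t), (y + t / 3) / (1 + t), (z + t / 3) / (1 + t),
    by positivity, by positivity, by positivity, ?_, ?_⟩
  · field_simp
    linarith
  · have h1 := congrArg Prod.fst heq
    have h2 := congrArg Prod.snd heq
    simp only [Prod.fst_add, Prod.snd_add, Prod.smul_fst, Prod.smul_snd, Prod.fst_sub,
      Prod.snd_sub, smul_eq_mul] at h1 h2
    ext
    · simp only [Prod.fst_add, Prod.smul_fst, smul_eq_mul]
      field_simp
      linear_combination 3 * h1
    · simp only [Prod.snd_add, Prod.smul_snd, smul_eq_mul]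
      field_simp
      linear_combination 3 * h2

theorem cross_eq_one_of_pos {w u v : ℤ × ℤ} (hpos : 0 < cross w u v)
    (h : ∀ q : ℤ × ℤ, toR q ∈ convexHull ℝ {toR w, toR u, toR v} → q = w ∨ q = u ∨ q = v) :
    cross w u v = 1 := by
  set D := cross w u v with hD
  have key : ∀ q : ℤ × ℤ, 0 ≤ cross w q v → 0 ≤ cross w u q →
      cross w q v + cross w u q ≤ D → (cross w q v = 0 ∧ cross w u q = 0) ∨
        (cross w q v = D ∧ cross w u q = 0) ∨ (cross w q v = 0 ∧ cross w u q = D) := by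
    intro q hA hB hAB
    have hDr : (0 : ℝ) < D := by exact_mod_cast hpos
    have hAr : (0 : ℝ) ≤ (cross w q v : ℤ) := by exact_mod_cast hA
    have hBr : (0 : ℝ) ≤ (cross w u q : ℤ) := by exact_mod_cast hB
    have hABr : ((cross w q v : ℤ) : ℝ) + (cross w u q : ℤ) ≤ D := by exact_mod_cast hAB
    have hmem : toR q ∈ convexHull ℝ {toR w, toR u, toR v} := by
      rw [mem_convexHull_triple]
      refine ⟨(D - (cross w q v : ℤ) - (cross w u q : ℤ)) / D, (cross w q v : ℤ) / D,
        (cross w u q : ℤ) / D, div_nonneg (by linarith) hDr.le, by positivity, by positivity,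
        by field_simp; ring, ?_⟩
      have hDdef : (D : ℝ) = cross (toR w) (toR u) (toR v) := by rw [cross_toR]
      rw [hDdef] at hDr ⊢
      have hD0 := hDr.ne'
      rw [← cross_toR, ← cross_toR]
      ext
      · simp only [Prod.fst_add, Prod.smul_fst, smul_eq_mul]
        field_simp
        simp only [cross]
        ring
      · simp only [Prod.snd_add, Prod.smul_snd, smul_eq_mul]
        field_simp
        simp only [cross]
        ring
    rcases h q hmem with rfl | rfl | rfl
    · left
      constructor <;> simp only [cross] <;> ring
    · right; left
      exact ⟨rfl, by simp only [cross]; ring⟩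
    · right; right
      exact ⟨by simp only [cross]; ring, rfl⟩
  have hdvd : ∀ m n : ℤ, D ∣ m * (v.2 - w.2) - n * (v.1 - w.1) ∧
      D ∣ (u.1 - w.1) * n - (u.2 - w.2) * m := by
    intro m n
    set A := m * (v.2 - w.2) - n * (v.1 - w.1) with hA
    set B := (u.1 - w.1) * n - (u.2 - w.2) * m with hB
    have hA0 := Int.emod_nonneg A hpos.ne'
    have hB0 := Int.emod_nonneg B hpos.ne'
    have hA1 := Int.emod_lt_of_pos A hpos
    have hB1 := Int.emod_lt_of_pos B hpos
    have hAe := Int.emod_add_mul_ediv A D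
    have hBe := Int.emod_add_mul_ediv B D
    rw [Int.dvd_iff_emod_eq_zero, Int.dvd_iff_emod_eq_zero]
    generalize A / D = k at *
    generalize B / D = l at *
    by_cases hle : A % D + B % D ≤ D
    · have hk := key (w.1 + m - k * (u.1 - w.1) - l * (v.1 - w.1),
        w.2 + n - k * (u.2 - w.2) - l * (v.2 - w.2))
      have e1 : cross w (w.1 + m - k * (u.1 - w.1) - l * (v.1 - w.1),
        w.2 + n - k * (u.2 - w.2) - l * (v.2 - w.2)) v = A % D := by
        have : A % D = A - D * k := by linarith
        rw [this, hA, hD]; simp only [cross]; ring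
      have e2 : cross w u (w.1 + m - k * (u.1 - w.1) - l * (v.1 - w.1),
        w.2 + n - k * (u.2 - w.2) - l * (v.2 - w.2)) = B % D := by
        have : B % D = B - D * l := by linarith
        rw [this, hB, hD]; simp only [cross]; ring
      rw [e1, e2] at hk
      have := hk hA0 hB0 hle
      omega
    · have hk := key (w.1 - m + (k + 1) * (u.1 - w.1) + (l + 1) * (v.1 - w.1),
        w.2 - n + (k + 1) * (u.2 - w.2) + (l + 1) * (v.2 - w.2))
      have e1 : cross w (w.1 - m + (k + 1) * (u.1 - w.1) + (l + 1) * (v.1 - w.1),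
        w.2 - n + (k + 1) * (u.2 - w.2) + (l + 1) * (v.2 - w.2)) v = D - A % D := by
        have : A % D = A - D * k := by linarith
        rw [this, hA, hD]; simp only [cross]; ring
      have e2 : cross w u (w.1 - m + (k + 1) * (u.1 - w.1) + (l + 1) * (v.1 - w.1),
        w.2 - n + (k + 1) * (u.2 - w.2) + (l + 1) * (v.2 - w.2)) = D - B % D := by
        have : B % D = B - D * l := by linarith
        rw [this, hB, hD]; simp only [cross]; ring
      rw [e1, e2] at hk
      have := hk (by omega) (by omega) (by omega)
      omega
  have h1 := hdvd 1 0
  have h2 := hdvd 0 1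
  have hv2 : D ∣ v.2 - w.2 := by simpa using h1.1
  have hv1 : D ∣ v.1 - w.1 := by
    have := h2.1
    rwa [zero_mul, zero_sub, one_mul, dvd_neg] at this
  have hu1 : D ∣ u.1 - w.1 := by simpa using h2.2
  have hu2 : D ∣ u.2 - w.2 := by
    have := h1.2
    rwa [mul_zero, zero_sub, mul_one, dvd_neg] at this
  have hDD : D * D ∣ D := by
    conv_rhs => rw [hD, cross]
    exact dvd_sub (mul_dvd_mul hu1 hv2) (mul_dvd_mul hu2 hv1)
  nlinarith [Int.le_of_dvd hpos hDD]

/-- A lattice triangle whose only lattice points are its vertices is unimodular. -/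
theorem abs_cross_eq_one {w u v : ℤ × ℤ} (hne : cross w u v ≠ 0)
    (h : ∀ q : ℤ × ℤ, toR q ∈ convexHull ℝ {toR w, toR u, toR v} → q = w ∨ q = u ∨ q = v) :
    |cross w u v| = 1 := by
  rcases hne.lt_or_gt with hlt | hgt
  · have hswap : cross w v u = -cross w u v := by simp only [cross]; ring
    have := cross_eq_one_of_pos (w := w) (u := v) (v := u) (by omega) fun q hq => by
      rw [Set.pair_comm] at hq
      have := h q hq
      tauto
    rw [abs_of_neg hlt]
    omega
  · rw [cross_eq_one_of_pos hgt h, abs_one]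

theorem exists_eq_triple_of_mem {α : Type*} {E : Set α} (hE : E.ncard = 3) {a : α} (ha : a ∈ E) :
    ∃ b c, a ≠ b ∧ a ≠ c ∧ b ≠ c ∧ E = {a, b, c} := by
  obtain ⟨x, y, z, hxy, hxz, hyz, rfl⟩ := Set.ncard_eq_three.1 hE
  rcases ha with rfl | rfl | rfl
  · exact ⟨y, z, hxy, hxz, hyz, rfl⟩
  · exact ⟨x, z, hxy.symm, hyz, hxz, Set.insert_comm _ _ _⟩
  · exact ⟨x, y, hxz.symm, hyz.symm, hxy, by ext; simp; tauto⟩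

theorem exists_eq_triple_of_mem_of_mem {α : Type*} {E : Set α} (hE : E.ncard = 3) {a b : α}
    (ha : a ∈ E) (hb : b ∈ E) (hab : a ≠ b) :
    ∃ c, a ≠ c ∧ b ≠ c ∧ E = {a, b, c} := by
  obtain ⟨x, y, hx, hy, hxy, rfl⟩ := exists_eq_triple_of_mem hE ha
  rcases hb with rfl | rfl | rfl
  · exact absurd rfl hab
  · exact ⟨y, hy, hxy, rfl⟩
  · exact ⟨x, hx, hxy.symm, by rw [Set.pair_comm]⟩

/-- If removing the vertex `v₁` from the triangle `v₁ v₂ v₃` leaves the triangle `v₂ v₃ w` with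
no further boundary lattice points, then the triangle `w v₁ v₂` is empty. -/
theorem eq_vertex_of_mem_convexHull {v₁ v₂ v₃ w : ℤ × ℤ} {Γ' : Set (ℝ × ℝ)}
    (hΓ' : Γ' = convexHull ℝ {toR v₂, toR v₃, toR w})
    (hpts : ∀ q, toR q ∈ convexHull ℝ {toR v₁, toR v₂, toR v₃} → q ≠ v₁ → toR q ∈ Γ')
    (hfr : latticePts (frontier Γ') ⊆ {v₂, v₃, w})
    (hne : cross (toR v₂) (toR w) (toR v₃) ≠ 0)
    (hw : toR w ∈ interior (convexHull ℝ {toR v₁, toR v₂, toR v₃}))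
    (q : ℤ × ℤ) (hq : toR q ∈ convexHull ℝ {toR w, toR v₁, toR v₂}) :
    q = w ∨ q = v₁ ∨ q = v₂ := by
  by_cases hq1 : q = v₁
  · exact Or.inr (Or.inl hq1)
  have hqΓ : toR q ∈ convexHull ℝ {toR v₁, toR v₂, toR v₃} := by
    refine convexHull_min ?_ (convex_convexHull ℝ _) hq
    rintro p (rfl | rfl | rfl)
    · exact interior_subset hw
    · exact subset_convexHull ℝ _ (by simp)
    · exact subset_convexHull ℝ _ (by simp)
  have hqΓ' := hpts q hqΓ hq1
  obtain ⟨z, x, y, hz, hx, hy, hsum, hqe⟩ := mem_convexHull_triple.1 hq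
  obtain ⟨r, s, t, hr, hs, ht, hsum', hqe'⟩ := mem_convexHull_triple.1 (hΓ' ▸ hqΓ')
  obtain ⟨α, β, γ, hα, hβ, hγ, hsumw, hwe⟩ := exists_pos_of_mem_interior_convexHull_triple hw
  have c0 : cross (toR v₂) (toR w) (toR v₂) = 0 := by simp [cross]
  have c1 : cross (toR v₂) (toR w) (toR w) = 0 := by simp only [cross]; ring
  have e1 := cross_combination (toR v₂) (toR w) (toR w) (toR v₁) (toR v₂) hsum
  have e2 := cross_combination (toR v₂) (toR w) (toR v₂) (toR v₃) (toR w) hsum'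
  have e3 := cross_combination (toR v₂) (toR w) (toR v₁) (toR v₂) (toR v₃) hsumw
  rw [← hqe, c0, c1] at e1
  rw [← hqe', c0, c1] at e2
  rw [← hwe, c0, c1] at e3
  have hs0 : s = 0 := by
    have : (α * s + γ * x) * cross (toR v₂) (toR w) (toR v₃) = 0 := by
      linear_combination α * e1 - α * e2 - x * e3
    have := (mul_eq_zero.1 this).resolve_right hne
    nlinarith [mul_nonneg hγ.le hx, mul_nonneg hα.le hs]
  have hq0 : cross (toR v₂) (toR w) (toR q) = 0 := by rw [e2, hs0]; ring
  have hni : toR q ∉ interior Γ' := by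
    rw [hΓ']
    intro hint
    obtain ⟨r, s, t, hr, hs, ht, hsum', hqe'⟩ := exists_pos_of_mem_interior_convexHull_triple hint
    have e2 := cross_combination (toR v₂) (toR w) (toR v₂) (toR v₃) (toR w) hsum'
    rw [← hqe', c0, c1, hq0] at e2
    have : s * cross (toR v₂) (toR w) (toR v₃) = 0 := by linarith
    exact (mul_ne_zero hs.ne' hne) this
  rcases hfr (show q ∈ latticePts (frontier Γ') from ⟨subset_closure hqΓ', hni⟩) with
    rfl | rfl | rfl
  · exact Or.inr (Or.inr rfl)
  · exact absurd hq0 hne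
  · exact Or.inl rfl

theorem stmt3 (Γ : Set (ℝ × ℝ))
    (hpoly : IsLatticePolygon Γ) (hdim : ¬ Collinear ℝ Γ)
    (hb : (latticePts (frontier Γ)).ncard = 3)
    (hSig : ¬ UnimodEquiv Γ SigmaTri)
    (hint : ¬ Collinear ℝ (interiorHull Γ))
    (v₁ : ℤ × ℤ) (hv : toR v₁ ∈ Set.extremePoints ℝ Γ) :
    ∀ Γ' : Set (ℝ × ℝ), Γ' = convexHull ℝ (toR '' (latticePts Γ \ {v₁})) →
      IsLatticePolygon Γ' ∧ ¬ Collinear ℝ Γ' ∧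
        4 ≤ (latticePts (frontier Γ')).ncard := by
  rintro Γ' rfl
  set S := latticePts Γ \ {v₁} with hS
  have hSfin : S.Finite := (finite_latticePts hpoly.isCompact.isBounded).subset Set.sdiff_subset
  have hpoly' : IsLatticePolygon (convexHull ℝ (toR '' S)) :=
    ⟨hSfin.toFinset, by rw [hSfin.coe_toFinset]⟩
  have hSΓ : toR '' S ⊆ Γ := by
    rintro _ ⟨p, hp, rfl⟩
    exact hp.1
  have hdim' : ¬ Collinear ℝ (convexHull ℝ (toR '' S)) := by
    refine fun hc => hint (hc.subset (convexHull_mono (Set.image_mono fun p hp => ?_)))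
    refine ⟨interior_subset (s := Γ) hp, ?_⟩
    rintro rfl
    exact notMem_interior_of_mem_extremePoints hv hp
  refine ⟨hpoly', hdim', ?_⟩
  by_contra! hlt
  obtain ⟨hE3, hEfr⟩ := hpoly.ncard_extremePoints_eq_three hdim hb.le
  obtain ⟨hE3', hEfr'⟩ := hpoly'.ncard_extremePoints_eq_three hdim' (by omega)
  obtain ⟨v₂, v₃, h12, h13, h23, hE⟩ := exists_eq_triple_of_mem hE3 (a := v₁) hv
  have hmem' : ∀ p ∈ latticePts (Γ.extremePoints ℝ), p ≠ v₁ →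
      p ∈ latticePts ((convexHull ℝ (toR '' S)).extremePoints ℝ) := fun p hp hne =>
    inter_extremePoints_subset_extremePoints_of_subset (convexHull_min hSΓ hpoly.convex)
      ⟨subset_convexHull ℝ _ ⟨p, ⟨hp.1, hne⟩, rfl⟩, hp⟩
  obtain ⟨w, h2w, h3w, hE'⟩ := exists_eq_triple_of_mem_of_mem hE3'
    (hmem' v₂ (by simp [hE]) h12.symm) (hmem' v₃ (by simp [hE]) h13.symm) h23
  have hΓ := hpoly.eq_convexHull_extremePoints
  have hΓ' := hpoly'.eq_convexHull_extremePoints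
  rw [hE, Set.image_insert_eq, Set.image_pair] at hΓ
  rw [hE', Set.image_insert_eq, Set.image_pair] at hΓ'
  have hwS : w ∈ S := by
    have hw : toR w ∈ (convexHull ℝ (toR '' S)).extremePoints ℝ :=
      show w ∈ latticePts ((convexHull ℝ (toR '' S)).extremePoints ℝ) by rw [hE']; simp
    obtain ⟨p, hp, hpw⟩ := extremePoints_convexHull_subset hw
    rwa [← toR_injective hpw]
  have hwint : toR w ∈ interior Γ := by
    by_contra hni
    have hwfr : w ∈ latticePts (frontier Γ) := ⟨subset_closure hwS.1, hni⟩
    rw [← hEfr, hE] at hwfr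
    rcases hwfr with h | h | h
    · exact hwS.2 h
    · exact h2w h.symm
    · exact h3w h.symm
  have hne : cross (toR v₂) (toR w) (toR v₃) ≠ 0 := by
    refine cross_ne_zero_of_not_collinear (toR_injective.ne h2w) fun hc => hdim' ?_
    rw [hΓ', collinear_convexHull, Set.pair_comm]
    exact hc
  have hpts : ∀ q, toR q ∈ Γ → q ≠ v₁ → toR q ∈ convexHull ℝ (toR '' S) :=
    fun q hq hq1 => subset_convexHull ℝ _ ⟨q, ⟨hq, hq1⟩, rfl⟩
  have hswap : ({toR v₁, toR v₃, toR v₂} : Set (ℝ × ℝ)) = {toR v₁, toR v₂, toR v₃} := by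
    rw [Set.pair_comm]
  have hempty₂ := eq_vertex_of_mem_convexHull (v₁ := v₁) hΓ' (hΓ ▸ hpts)
    (by rw [← hEfr', hE']) hne (hΓ ▸ hwint)
  have hempty₃ := eq_vertex_of_mem_convexHull (v₁ := v₁) (v₂ := v₃) (v₃ := v₂)
    (hΓ'.trans (by rw [Set.insert_comm])) (by rw [hswap, ← hΓ]; exact hpts)
    (by rw [← hEfr', hE', Set.insert_comm])
    (by
      intro h0
      apply hne
      simp only [cross] at h0 ⊢
      linarith)
    (by rw [hswap, ← hΓ]; exact hwint)
  obtain ⟨α, β, γ, hα, hβ, hγ, hsum, hwe⟩ :=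
    exists_pos_of_mem_interior_convexHull_triple (hΓ ▸ hwint)
  have c0 : cross (toR w) (toR v₁) (toR v₁) = 0 := by simp only [cross]; ring
  have c1 : cross (toR w) (toR v₁) (toR w) = 0 := by simp [cross]
  have e := cross_combination (toR w) (toR v₁) (toR v₁) (toR v₂) (toR v₃) hsum
  have e' := cross_combination (toR v₂) (toR w) (toR v₁) (toR v₂) (toR v₃) hsum
  have e'' := cross_combination (toR v₃) (toR w) (toR v₁) (toR v₂) (toR v₃) hsum
  rw [← hwe] at e e' e''
  rw [c0, c1] at e
  have hne₂ : cross w v₁ v₂ ≠ 0 := by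
    intro h0
    have h0r : cross (toR w) (toR v₁) (toR v₂) = 0 := by rw [cross_toR, h0, Int.cast_zero]
    have : γ * cross (toR v₂) (toR w) (toR v₃) = 0 := by
      simp only [cross] at e' h0r ⊢
      linear_combination -e' - α * h0r
    exact mul_ne_zero hγ.ne' hne this
  have hne₃ : cross w v₁ v₃ ≠ 0 := by
    intro h0
    have h0r : cross (toR w) (toR v₁) (toR v₃) = 0 := by rw [cross_toR, h0, Int.cast_zero]
    have : β * cross (toR v₂) (toR w) (toR v₃) = 0 := by
      simp only [cross] at e'' h0r ⊢
      linear_combination e'' + α * h0r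
    exact mul_ne_zero hβ.ne' hne this
  have a2 := abs_cross_eq_one hne₂ hempty₂
  have a3 := abs_cross_eq_one hne₃ hempty₃
  have hopp : cross w v₁ v₃ = -cross w v₁ v₂ := by
    rw [cross_toR, cross_toR] at e
    rcases (abs_eq zero_le_one).1 a2 with h2 | h2 <;>
      rcases (abs_eq zero_le_one).1 a3 with h3 | h3 <;>
      rw [h2, h3] at e ⊢ <;> push_cast at e <;> first | rfl | linarith
  apply hint
  rw [interiorHull, collinear_convexHull]
  refine collinear_of_forall_cross_eq_zero (a := toR w) (b := toR v₁)
    (toR_injective.ne hwS.2) ?_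
  rintro _ ⟨q, hq, rfl⟩
  have hq : toR q ∈ interior Γ := hq
  rw [hΓ] at hq
  obtain ⟨x, y, z, hx, hy, hz, hsumq, hqe⟩ := exists_pos_of_mem_interior_convexHull_triple hq
  have eq := cross_combination (toR w) (toR v₁) (toR v₁) (toR v₂) (toR v₃) hsumq
  rw [← hqe, c0, cross_toR, cross_toR, cross_toR, hopp] at eq
  rw [cross_toR]
  have habs : |cross w v₁ q| < 1 := by
    rcases (abs_eq zero_le_one).1 a2 with h2 | h2 <;> rw [h2] at eq <;> push_cast at eq <;>
      rw [abs_lt] <;> constructor <;> rify <;> linarith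
  rw [Int.abs_lt_one_iff.1 habs, Int.cast_zero]
end
end

section
/- Let Δ ⊂ ℝ² be a two-dimensional lattice polygon such that Δ^{(1)} is two-dimensional, and let d ≥ 2 be an integer. Then for every lattice point u ∈ ((d−1)Δ^{(1)})^{(1)} ∩ ℤ² and every lattice point p ∈ Δ ∩ ℤ², there exist v₁, …, v_d ∈ Δ^{(1)} ∩ ℤ² such that p + u = v₁ + ⋯ + v_d. -/
open Pointwise

noncomputable section

/-- Twice the signed area of the lattice triangle with vertices `a`, `b`, `c`. -/
def orient (a b c : ℤ × ℤ) : ℤ :=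
  (b.1 - a.1) * (c.2 - a.2) - (b.2 - a.2) * (c.1 - a.1)

/-- `x` is the combination of `a`, `b`, `c` with nonnegative coefficients `α`, `β`, `γ` of total
mass `n`. -/
structure Combo (n : ℝ) (x a b c : ℤ × ℤ) (α β γ : ℝ) : Prop where
  nonneg₁ : 0 ≤ α
  nonneg₂ : 0 ≤ β
  nonneg₃ : 0 ≤ γ
  mass : α + β + γ = n
  fst : (x.1 : ℝ) = α * a.1 + β * b.1 + γ * c.1
  snd : (x.2 : ℝ) = α * a.2 + β * b.2 + γ * c.2

lemma natAbs_lt_of_eq_mul {D E : ℤ} {m : ℝ} (h : (E : ℝ) = m * D) (hm : 0 < m) (hm1 : m < 1)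
    (hD : D ≠ 0) : E ≠ 0 ∧ E.natAbs < D.natAbs := by
  have hD' : (D : ℝ) ≠ 0 := by exact_mod_cast hD
  refine ⟨fun h0 => ?_, ?_⟩
  · rw [h0] at h
    have : m * (D : ℝ) ≠ 0 := mul_ne_zero hm.ne' hD'
    exact this (by simpa using h.symm)
  · have h1 : |(E : ℝ)| < |(D : ℝ)| := by
      rw [h, abs_mul, abs_of_pos hm]
      nlinarith [abs_pos.mpr hD']
    have h2 : |E| < |D| := by exact_mod_cast h1
    rw [Int.abs_eq_natAbs, Int.abs_eq_natAbs] at h2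
    exact_mod_cast h2

lemma exists_sum_succ {S : Set (ℤ × ℤ)} {n : ℕ} {x q : ℤ × ℤ} (hq : q ∈ S)
    (h : ∃ v : Fin n → ℤ × ℤ, (∀ i, v i ∈ S) ∧ x - q = ∑ i, v i) :
    ∃ v : Fin (n + 1) → ℤ × ℤ, (∀ i, v i ∈ S) ∧ x = ∑ i, v i := by
  obtain ⟨v, hv, hx⟩ := h
  refine ⟨Fin.cons q v, fun i => ?_, ?_⟩
  · refine Fin.cases ?_ (fun j => ?_) i
    · simpa using hq
    · simpa using hv j
  · rw [Fin.sum_univ_succ]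
    simp only [Fin.cons_zero, Fin.cons_succ]
    rw [← hx]
    abel

/-- A lattice point in a nondegenerate triangle dilated by `n`, with at most the first vertex `p`
outside `S` and then occurring with coefficient below `1`, is a sum of `n` points of `S`. -/
lemma exists_sum_of_combo {S : Set (ℤ × ℤ)} {p : ℤ × ℤ}
    (hS : ∀ {w a b c : ℤ × ℤ} {α β γ : ℝ}, (a ∈ S ∨ a = p) → b ∈ S → c ∈ S →
      Combo 1 w a b c α β γ → α < 1 → w ∈ S) (D : ℕ) :
    ∀ (n : ℕ) (x a b c : ℤ × ℤ) (α β γ : ℝ), (orient a b c).natAbs = D → orient a b c ≠ 0 →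
      (a ∈ S ∨ a = p ∧ α < 1) → b ∈ S → c ∈ S → Combo n x a b c α β γ →
      ∃ v : Fin n → ℤ × ℤ, (∀ i, v i ∈ S) ∧ x = ∑ i, v i := by
  induction D using Nat.strong_induction_on with
  | _ D ihD =>
  intro n
  induction n with
  | zero =>
    intro x a b c α β γ _ _ _ _ _ h
    obtain ⟨h1, h2, h3, hm, hx, hy⟩ := h
    push_cast at hm
    obtain rfl : α = 0 := by linarith
    obtain rfl : β = 0 := by linarith
    obtain rfl : γ = 0 := by linarith
    refine ⟨Fin.elim0, fun i => i.elim0, ?_⟩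
    have hx' : x.1 = 0 := by simpa using hx
    have hy' : x.2 = 0 := by simpa using hy
    ext <;> simp [hx', hy']
  | succ n ihn =>
    intro x a b c α β γ hD hne ha hb hc h
    obtain ⟨h1, h2, h3, hm, hx, hy⟩ := h
    push_cast at hm
    by_cases hβ : 1 ≤ β
    · refine exists_sum_succ hb (ihn (x - b) a b c α (β - 1) γ hD hne ha hb hc
        ⟨h1, by linarith, h3, by linarith, ?_, ?_⟩) <;> push_cast [Prod.fst_sub, Prod.snd_sub] <;>
        linarith
    by_cases hγ : 1 ≤ γ
    · refine exists_sum_succ hc (ihn (x - c) a b c α β (γ - 1) hD hne ha hb hc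
        ⟨h1, h2, by linarith, by linarith, ?_, ?_⟩) <;> push_cast [Prod.fst_sub, Prod.snd_sub] <;>
        linarith
    by_cases hα : 1 ≤ α
    · have haS : a ∈ S := ha.resolve_right fun h => by linarith [h.2]
      refine exists_sum_succ haS (ihn (x - a) a b c (α - 1) β γ hD hne (Or.inl haS) hb hc
        ⟨by linarith, h2, h3, by linarith, ?_, ?_⟩) <;> push_cast [Prod.fst_sub, Prod.snd_sub] <;>
        linarith
    push Not at hα hβ hγ
    have ha' : a ∈ S ∨ a = p := ha.imp_right And.left
    have hn : n < 2 := by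
      have : (n : ℝ) < 2 := by linarith
      exact_mod_cast this
    obtain rfl | rfl : n = 0 ∨ n = 1 := by omega
    · refine ⟨fun _ => x, fun _ => hS ha' hb hc ⟨h1, h2, h3, ?_, hx, hy⟩ hα, by simp⟩
      simpa using hm
    push_cast at hm
    obtain ⟨w, hw⟩ : ∃ w, w = a + b + c - x := ⟨_, rfl⟩
    have hw1 : (w.1 : ℝ) = (1 - α) * a.1 + (1 - β) * b.1 + (1 - γ) * c.1 := by
      rw [hw]; push_cast [Prod.fst_sub, Prod.fst_add]; linarith
    have hw2 : (w.2 : ℝ) = (1 - α) * a.2 + (1 - β) * b.2 + (1 - γ) * c.2 := by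
      rw [hw]; push_cast [Prod.snd_sub, Prod.snd_add]; linarith
    have hwS : w ∈ S := hS (α := 1 - α) (β := 1 - β) (γ := 1 - γ) ha' hb hc
      ⟨by linarith, by linarith, by linarith, by linarith, hw1, hw2⟩ (by linarith)
    have hα0 : 0 < 1 - α := by linarith
    have hβ0 : 0 < 1 - β := by linarith
    have hγ0 : 0 < 1 - γ := by linarith
    have key : (∃ k, 0 ≤ k ∧ α = k * (1 - α) ∧ k * (1 - β) ≤ β ∧ k * (1 - γ) ≤ γ) ∨
        (∃ k, 0 ≤ k ∧ β = k * (1 - β) ∧ k * (1 - α) ≤ α ∧ k * (1 - γ) ≤ γ) ∨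
        (∃ k, 0 ≤ k ∧ γ = k * (1 - γ) ∧ k * (1 - α) ≤ α ∧ k * (1 - β) ≤ β) := by
      have e : ∀ {s : ℝ}, 0 < 1 - s → s = s / (1 - s) * (1 - s) := fun hs =>
        (div_mul_cancel₀ _ hs.ne').symm
      rcases le_total (α / (1 - α)) (β / (1 - β)) with h12 | h12 <;>
      rcases le_total (α / (1 - α)) (γ / (1 - γ)) with h13 | h13 <;>
      rcases le_total (β / (1 - β)) (γ / (1 - γ)) with h23 | h23
      all_goals first
        | exact Or.inl ⟨_, div_nonneg h1 hα0.le, e hα0, (le_div_iff₀ hβ0).mp (by linarith),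
            (le_div_iff₀ hγ0).mp (by linarith)⟩
        | exact Or.inr (Or.inl ⟨_, div_nonneg h2 hβ0.le, e hβ0, (le_div_iff₀ hα0).mp (by linarith),
            (le_div_iff₀ hγ0).mp (by linarith)⟩)
        | exact Or.inr (Or.inr ⟨_, div_nonneg h3 hγ0.le, e hγ0, (le_div_iff₀ hα0).mp (by linarith),
            (le_div_iff₀ hβ0).mp (by linarith)⟩)
    have hγe : γ = 2 - α - β := by linarith
    rcases key with ⟨k, hk, e, i, j⟩ | ⟨k, hk, e, i, j⟩ | ⟨k, hk, e, i, j⟩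
    · have hdet : (orient w b c : ℝ) = (1 - α) * orient a b c := by
        simp only [orient]; push_cast; rw [hw1, hw2, hγe]; ring
      obtain ⟨hne', hlt⟩ := natAbs_lt_of_eq_mul hdet hα0 (by linarith) hne
      refine ihD _ (hD ▸ hlt) 2 x w b c k (β - k * (1 - β)) (γ - k * (1 - γ)) rfl hne'
        (Or.inl hwS) hb hc ⟨hk, by linarith, by linarith, ?_, ?_, ?_⟩
      · push_cast; linear_combination hm - e + k * hm
      · rw [hw1, hx]; linear_combination (a.1 : ℝ) * e
      · rw [hw2, hy]; linear_combination (a.2 : ℝ) * e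
    · have hdet : (orient a w c : ℝ) = (1 - β) * orient a b c := by
        simp only [orient]; push_cast; rw [hw1, hw2, hγe]; ring
      obtain ⟨hne', hlt⟩ := natAbs_lt_of_eq_mul hdet hβ0 (by linarith) hne
      refine ihD _ (hD ▸ hlt) 2 x a w c (α - k * (1 - α)) k (γ - k * (1 - γ)) rfl hne'
        (ha.imp_right fun h => ⟨h.1, by nlinarith⟩) hwS hc ⟨by linarith, hk, by linarith, ?_, ?_, ?_⟩
      · push_cast; linear_combination hm - e + k * hm
      · rw [hw1, hx]; linear_combination (b.1 : ℝ) * e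
      · rw [hw2, hy]; linear_combination (b.2 : ℝ) * e
    · have hdet : (orient a b w : ℝ) = (1 - γ) * orient a b c := by
        simp only [orient]; push_cast; rw [hw1, hw2, hγe]; ring
      obtain ⟨hne', hlt⟩ := natAbs_lt_of_eq_mul hdet hγ0 (by linarith) hne
      refine ihD _ (hD ▸ hlt) 2 x a b w (α - k * (1 - α)) (β - k * (1 - β)) k rfl hne'
        (ha.imp_right fun h => ⟨h.1, by nlinarith⟩) hb hwS ⟨by linarith, by linarith, hk, ?_, ?_, ?_⟩
      · push_cast; linear_combination hm - e + k * hm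
      · rw [hw1, hx]; linear_combination (c.1 : ℝ) * e
      · rw [hw2, hy]; linear_combination (c.2 : ℝ) * e

lemma exists_first_zero {l : ℝ} {s c : ℝ} (hs : 0 ≤ s) (hc : 0 ≤ c) :
    ∃ τ, 0 ≤ τ ∧ τ ≤ s ∧ (∀ t, 0 ≤ t → t ≤ τ → 0 ≤ c + t * l) ∧
      (τ = s ∨ l ≠ 0 ∧ c + τ * l = 0) := by
  by_cases h : 0 ≤ c + s * l
  · refine ⟨s, hs, le_rfl, fun t ht hts => ?_, Or.inl rfl⟩
    rcases le_total 0 l with hl | hl <;> nlinarith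
  · push Not at h
    have hl : l < 0 := by by_contra! hl; nlinarith
    have e : c / (-l) * l = -c := by
      rw [div_neg, neg_mul, div_mul_cancel₀ _ hl.ne]
    refine ⟨c / (-l), div_nonneg hc (by linarith), ?_, fun t ht hts => ?_,
      Or.inr ⟨hl.ne, by linarith⟩⟩
    · rw [div_le_iff₀ (by linarith)]; linarith
    · nlinarith

/-- Carathéodory-type reduction: from a combination of `p` and a nondegenerate triangle in `S`, one
passes to three of the four points without increasing the coefficient of `p`. -/
lemma exists_combo_of_four {S : Set (ℤ × ℤ)} {p x a b c : ℤ × ℤ} {n s α β γ : ℝ}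
    (ha : a ∈ S) (hb : b ∈ S) (hc : c ∈ S) (hD : orient a b c ≠ 0)
    (hs : 0 ≤ s) (hs1 : s < 1) (hα : 0 ≤ α) (hβ : 0 ≤ β) (hγ : 0 ≤ γ)
    (hm : s + α + β + γ = n)
    (hx : (x.1 : ℝ) = s * p.1 + α * a.1 + β * b.1 + γ * c.1)
    (hy : (x.2 : ℝ) = s * p.2 + α * a.2 + β * b.2 + γ * c.2) :
    ∃ (a b c : ℤ × ℤ) (α β γ : ℝ), orient a b c ≠ 0 ∧ (a ∈ S ∨ a = p ∧ α < 1) ∧ b ∈ S ∧ c ∈ S ∧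
      Combo n x a b c α β γ := by
  have hD' : (orient a b c : ℝ) ≠ 0 := by exact_mod_cast hD
  obtain ⟨l₁, h₁⟩ : ∃ l : ℝ, l * orient a b c = orient p b c := ⟨_, div_mul_cancel₀ _ hD'⟩
  obtain ⟨l₂, h₂⟩ : ∃ l : ℝ, l * orient a b c = orient a p c := ⟨_, div_mul_cancel₀ _ hD'⟩
  obtain ⟨l₃, h₃⟩ : ∃ l : ℝ, l * orient a b c = orient a b p := ⟨_, div_mul_cancel₀ _ hD'⟩
  have hl : l₁ + l₂ + l₃ = 1 := by
    apply mul_right_cancel₀ hD'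
    rw [add_mul, add_mul, h₁, h₂, h₃]; simp only [orient]; push_cast; ring
  have hp1 : (p.1 : ℝ) = l₁ * a.1 + l₂ * b.1 + l₃ * c.1 := by
    apply mul_right_cancel₀ hD'
    have : (l₁ * a.1 + l₂ * b.1 + l₃ * c.1) * orient a b c =
        (l₁ * orient a b c) * a.1 + (l₂ * orient a b c) * b.1 + (l₃ * orient a b c) * c.1 := by ring
    rw [this, h₁, h₂, h₃]; simp only [orient]; push_cast; ring
  have hp2 : (p.2 : ℝ) = l₁ * a.2 + l₂ * b.2 + l₃ * c.2 := by
    apply mul_right_cancel₀ hD'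
    have : (l₁ * a.2 + l₂ * b.2 + l₃ * c.2) * orient a b c =
        (l₁ * orient a b c) * a.2 + (l₂ * orient a b c) * b.2 + (l₃ * orient a b c) * c.2 := by ring
    rw [this, h₁, h₂, h₃]; simp only [orient]; push_cast; ring
  have hne : ∀ {l : ℝ} {E : ℤ}, l ≠ 0 → l * orient a b c = E → E ≠ 0 := by
    intro l E hl h h0
    rw [h0, Int.cast_zero] at h
    exact mul_ne_zero hl hD' h
  have key : ∃ t, 0 ≤ t ∧ t ≤ s ∧ 0 ≤ α + t * l₁ ∧ 0 ≤ β + t * l₂ ∧ 0 ≤ γ + t * l₃ ∧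
      (t = s ∨ (l₁ ≠ 0 ∧ α + t * l₁ = 0) ∨ (l₂ ≠ 0 ∧ β + t * l₂ = 0) ∨
        (l₃ ≠ 0 ∧ γ + t * l₃ = 0)) := by
    obtain ⟨t₁, p₁, q₁, r₁, e₁⟩ := exists_first_zero (l := l₁) hs hα
    obtain ⟨t₂, p₂, q₂, r₂, e₂⟩ := exists_first_zero (l := l₂) hs hβ
    obtain ⟨t₃, p₃, q₃, r₃, e₃⟩ := exists_first_zero (l := l₃) hs hγ
    have : ∃ t, (t = t₁ ∨ t = t₂ ∨ t = t₃) ∧ t ≤ t₁ ∧ t ≤ t₂ ∧ t ≤ t₃ := by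
      rcases le_total t₁ t₂ with h | h <;> rcases le_total t₁ t₃ with h' | h' <;>
      rcases le_total t₂ t₃ with h'' | h''
      all_goals first
        | exact ⟨t₁, by simp, le_rfl, by linarith, by linarith⟩
        | exact ⟨t₂, by simp, by linarith, le_rfl, by linarith⟩
        | exact ⟨t₃, by simp, by linarith, by linarith, le_rfl⟩
    obtain ⟨t, ht, i₁, i₂, i₃⟩ := this
    have ht0 : 0 ≤ t := by rcases ht with rfl | rfl | rfl <;> assumption
    refine ⟨t, ht0, by linarith, r₁ t ht0 i₁, r₂ t ht0 i₂, r₃ t ht0 i₃, ?_⟩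
    rcases ht with rfl | rfl | rfl <;> tauto
  obtain ⟨t, ht0, hts, g₁, g₂, g₃, rfl | ⟨hl', e⟩ | ⟨hl', e⟩ | ⟨hl', e⟩⟩ := key
  · refine ⟨a, b, c, _, _, _, hD, Or.inl ha, hb, hc, g₁, g₂, g₃, ?_, ?_, ?_⟩
    · linear_combination hm + t * hl
    · rw [hx, hp1]; ring
    · rw [hy, hp2]; ring
  · refine ⟨p, b, c, s - t, _, _, hne hl' h₁, Or.inr ⟨rfl, by linarith⟩, hb, hc,
      by linarith, g₂, g₃, ?_, ?_, ?_⟩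
    · linear_combination hm + t * hl - e
    · linear_combination hx + t * hp1 + e * a.1
    · linear_combination hy + t * hp2 + e * a.2
  · refine ⟨p, a, c, s - t, _, _, ?_, Or.inr ⟨rfl, by linarith⟩, ha, hc,
      by linarith, g₁, g₃, ?_, ?_, ?_⟩
    · have : orient p a c = -orient a p c := by simp only [orient]; ring
      rw [this]; exact neg_ne_zero.mpr (hne hl' h₂)
    · linear_combination hm + t * hl - e
    · linear_combination hx + t * hp1 + e * b.1
    · linear_combination hy + t * hp2 + e * b.2
  · refine ⟨p, a, b, s - t, _, _, ?_, Or.inr ⟨rfl, by linarith⟩, ha, hb,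
      by linarith, g₁, g₂, ?_, ?_, ?_⟩
    · have : orient p a b = orient a b p := by simp only [orient]; ring
      rw [this]; exact hne hl' h₃
    · linear_combination hm + t * hl - e
    · linear_combination hx + t * hp1 + e * c.1
    · linear_combination hy + t * hp2 + e * c.2

lemma collinear_of_orient_eq_zero {S : Set (ℤ × ℤ)} {a b : ℤ × ℤ} (ha : a ∈ S) (hab : a ≠ b)
    (h : ∀ c ∈ S, orient a b c = 0) : Collinear ℝ (toR '' S) := by
  rw [collinear_iff_of_mem (Set.mem_image_of_mem toR ha)]
  refine ⟨toR b - toR a, ?_⟩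
  rintro _ ⟨c, hc, rfl⟩
  have h0 : ((b.1 : ℝ) - a.1) * (c.2 - a.2) - (b.2 - a.2) * (c.1 - a.1) = 0 := by
    exact_mod_cast h c hc
  by_cases h1 : b.1 = a.1
  · have h2 : (b.2 : ℝ) - a.2 ≠ 0 := by
      rw [sub_ne_zero]
      intro h2
      exact hab (Prod.ext h1.symm (by exact_mod_cast h2.symm))
    refine ⟨(c.2 - a.2) / (b.2 - a.2), Prod.ext ?_ ?_⟩ <;> simp [toR] <;> field_simp <;> linarith
  · have h2 : (b.1 : ℝ) - a.1 ≠ 0 := by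
      rw [sub_ne_zero]
      exact_mod_cast h1
    refine ⟨(c.1 - a.1) / (b.1 - a.1), Prod.ext ?_ ?_⟩ <;> simp [toR] <;> field_simp <;> linarith

/-- Every point of the convex hull of a noncollinear set of lattice points lies in a nondegenerate
triangle spanned by that set. -/
lemma exists_triangle {S : Set (ℤ × ℤ)} (hS : ¬ Collinear ℝ (toR '' S)) {y : ℝ × ℝ}
    (hy : y ∈ convexHull ℝ (toR '' S)) :
    ∃ (a b c : ℤ × ℤ) (α β γ : ℝ), a ∈ S ∧ b ∈ S ∧ c ∈ S ∧ orient a b c ≠ 0 ∧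
      0 ≤ α ∧ 0 ≤ β ∧ 0 ≤ γ ∧ α + β + γ = 1 ∧ y = α • toR a + β • toR b + γ • toR c := by
  have third : ∀ {a b}, a ∈ S → a ≠ b → ∃ c ∈ S, orient a b c ≠ 0 := by
    intro a b ha hab
    by_contra! h
    exact hS (collinear_of_orient_eq_zero ha hab h)
  have second : ∀ a ∈ S, ∃ b ∈ S, a ≠ b := by
    intro a ha
    by_contra! h
    refine hS ?_
    rw [show S = {a} from Set.eq_singleton_iff_unique_mem.mpr ⟨ha, fun b hb => (h b hb).symm⟩,
      Set.image_singleton]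
    exact collinear_singleton _ _
  obtain ⟨ι, _, z, w, hz, hind, hw, hw1, rfl⟩ := eq_pos_convex_span_of_mem_convexHull hy
  have hcard : Fintype.card ι ≤ 3 := by
    refine hind.card_le_finrank_succ.trans ?_
    have := Submodule.finrank_le (vectorSpan ℝ (Set.range z))
    rw [Module.finrank_prod, Module.finrank_self] at this
    omega
  choose q hqS hq using fun i => hz (Set.mem_range_self i)
  let e := Fintype.equivFin ι
  have hinj : Function.Injective q := fun i j h => hind.injective (by rw [← hq i, ← hq j, h])
  simp only [← hq]
  rw [← e.symm.sum_comp] at hw1 ⊢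
  replace hind := (hind.comp_embedding e.symm.toEmbedding)
  replace hinj := hinj.comp e.symm.injective
  have hqz : z = toR ∘ q := funext fun i => (hq i).symm
  rw [hqz] at hind
  have hqS' := fun i => hqS (e.symm i)
  have hw' := fun i => (hw (e.symm i)).le
  generalize e.symm = f at *
  clear_value e
  generalize Fintype.card ι = k at *
  interval_cases k
  · simp at hw1
  · obtain ⟨b, hb, hab⟩ := second _ (hqS' 0)
    obtain ⟨c, hc, h⟩ := third (hqS' 0) hab
    refine ⟨_, b, c, _, 0, 0, hqS' 0, hb, hc, h, hw' 0, le_rfl, le_rfl, by simpa using hw1, ?_⟩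
    simp
  · obtain ⟨c, hc, h⟩ := third (hqS' 0) (fun h => absurd (hinj h) (by simp : (0 : Fin 2) ≠ 1))
    refine ⟨_, _, c, _, _, 0, hqS' 0, hqS' 1, hc, h, hw' 0, hw' 1, le_rfl, ?_, ?_⟩
    · simpa [Fin.sum_univ_two] using hw1
    · simp [Fin.sum_univ_two]
  · refine ⟨_, _, _, _, _, _, hqS' 0, hqS' 1, hqS' 2, ?_, hw' 0, hw' 1, hw' 2, ?_, ?_⟩
    · intro h0
      rw [affineIndependent_iff_not_collinear] at hind
      refine hind ?_
      have := collinear_of_orient_eq_zero (S := Set.range (q ∘ f)) (a := q (f 0)) (b := q (f 1))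
        ⟨0, rfl⟩ (fun h => absurd (hinj h) (by simp)) (by
          rintro _ ⟨i, rfl⟩
          fin_cases i
          · simp [orient]
          · simp only [orient, Function.comp_apply, Fin.mk_one]; ring
          · exact h0)
      rwa [← Set.range_comp] at this
    · simpa [Fin.sum_univ_three] using hw1
    · simp [Fin.sum_univ_three]

lemma Convex.mem_interior_of_combo {Δ : Set (ℝ × ℝ)} (hΔ : Convex ℝ Δ) {w a b c : ℤ × ℤ}
    {α β γ : ℝ} (ha : toR a ∈ Δ) (hb : toR b ∈ interior Δ) (hc : toR c ∈ interior Δ)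
    (h : Combo 1 w a b c α β γ) (hα : α < 1) : toR w ∈ interior Δ := by
  obtain ⟨h1, h2, h3, hm, hx, hy⟩ := h
  have hs : 0 < β + γ := by linarith
  have hq : (β / (β + γ)) • toR b + (γ / (β + γ)) • toR c ∈ interior Δ :=
    hΔ.interior hb hc (by positivity) (by positivity) (by field_simp)
  have := hΔ.combo_self_interior_mem_interior ha hq h1 hs (by linarith)
  convert this using 1
  rw [smul_add, smul_smul, smul_smul, mul_div_cancel₀ _ hs.ne', mul_div_cancel₀ _ hs.ne']
  ext <;> simp [toR, hx, hy] <;> ring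

lemma interiorHull_subset_interior {P : Set (ℝ × ℝ)} (hP : Convex ℝ P) :
    interiorHull P ⊆ interior P :=
  convexHull_min (Set.image_subset_iff.mpr fun _ h => h) hP.interior

/-- If `z` is interior to `Q`, the point `p + m • z` is also a combination of `p` and a point of `Q`
in which `p` has coefficient below `1`. -/
lemma exists_combo_of_mem_interior {Q : Set (ℝ × ℝ)} {z : ℝ × ℝ} (hz : z ∈ interior Q)
    (p : ℝ × ℝ) {m : ℝ} (hm : 0 < m) :
    ∃ (y : ℝ × ℝ) (s t : ℝ), y ∈ Q ∧ 0 ≤ s ∧ s < 1 ∧ 0 ≤ t ∧ s + t = m + 1 ∧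
      p + m • z = s • p + t • y := by
  have hcont : Continuous fun ε : ℝ => z + ε • (p - z) := by fun_prop
  have hev : ∀ᶠ ε in nhdsWithin (0 : ℝ) (Set.Ioi 0), z + ε • (p - z) ∈ interior Q :=
    (hcont.tendsto' 0 z (by simp)).mono_left nhdsWithin_le_nhds
      (isOpen_interior.mem_nhds hz)
  have hev' : ∀ᶠ ε in nhdsWithin (0 : ℝ) (Set.Ioi 0), ε ∈ Set.Ioo 0 (1 / (m + 1)) :=
    Ioo_mem_nhdsGT (by positivity)
  obtain ⟨ε, hε, hε0, hε1⟩ := (hev.and hev').exists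
  have hε2 : ε * (m + 1) < 1 := (lt_div_iff₀ (by linarith)).mp hε1
  have hlt : 0 < 1 - ε := by nlinarith
  have hmε : m / (1 - ε) * (1 - ε) = m := div_mul_cancel₀ _ hlt.ne'
  have ht : 0 < m / (1 - ε) := by positivity
  refine ⟨_, 1 - m / (1 - ε) * ε, m / (1 - ε), interior_subset hε, ?_, ?_, ht.le, ?_, ?_⟩
  · rw [div_mul_eq_mul_div, sub_nonneg, div_le_one hlt]
    linarith
  · nlinarith
  · linear_combination hmε
  · nth_rewrite 1 [← hmε]
    module

theorem stmt7 (Δ : Set (ℝ × ℝ))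
    (hpoly : IsLatticePolygon Δ) (hdim : ¬ Collinear ℝ Δ)
    (hdim1 : ¬ Collinear ℝ (interiorHull Δ))
    (d : ℕ) (hd : 2 ≤ d)
    (u : ℤ × ℤ) (hu : toR u ∈ interiorHull (((d : ℝ) - 1) • interiorHull Δ))
    (p : ℤ × ℤ) (hp : toR p ∈ Δ) :
    ∃ v : Fin d → ℤ × ℤ,
      (∀ i, toR (v i) ∈ interiorHull Δ) ∧ p + u = ∑ i, v i := by
  have hΔ : Convex ℝ Δ := by
    obtain ⟨S, rfl⟩ := hpoly
    exact convex_convexHull ℝ _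
  have hQ : Convex ℝ (interiorHull Δ) := convex_convexHull ℝ _
  have hd' : (2 : ℝ) ≤ d := by exact_mod_cast hd
  have hd1 : (0 : ℝ) < d - 1 := by linarith
  have hu' := interiorHull_subset_interior (hQ.smul _) hu
  rw [interior_smul₀ hd1.ne'] at hu'
  obtain ⟨z, hz, hzu⟩ := hu'
  obtain ⟨y, s, t, hy, hs, hs1, ht, hst, hxy⟩ := exists_combo_of_mem_interior hz (toR p) hd1
  have hcol : ¬ Collinear ℝ (toR '' latticePts (interior Δ)) := by
    rw [Collinear, ← direction_affineSpan] at hdim1 ⊢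
    rwa [interiorHull, affineSpan_convexHull] at hdim1
  obtain ⟨a, b, c, α, β, γ, ha, hb, hc, hD, hα, hβ, hγ, hsum, rfl⟩ := exists_triangle hcol hy
  have hxy' : toR p + toR u = s • toR p + t • (α • toR a + β • toR b + γ • toR c) := by
    rw [← hxy, ← hzu]
  obtain ⟨a', b', c', α', β', γ', hD', ha', hb', hc', h⟩ :=
    exists_combo_of_four (S := latticePts (interior Δ)) (p := p) (x := p + u) (n := d)
      ha hb hc hD hs hs1 (mul_nonneg ht hα) (mul_nonneg ht hβ) (mul_nonneg ht hγ)
      (by linear_combination hst + t * hsum)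
      (by
        have := congrArg Prod.fst hxy'
        simp only [toR, Prod.fst_add, Prod.smul_fst, smul_eq_mul] at this
        push_cast [Prod.fst_add]
        linarith)
      (by
        have := congrArg Prod.snd hxy'
        simp only [toR, Prod.snd_add, Prod.smul_snd, smul_eq_mul] at this
        push_cast [Prod.snd_add]
        linarith)
  obtain ⟨v, hv, hsumv⟩ := exists_sum_of_combo (S := latticePts (interior Δ)) (p := p)
    (fun ha hb hc h hlt => hΔ.mem_interior_of_combo
      (ha.elim (fun h => interior_subset h) (fun h => h ▸ hp)) hb hc h hlt)
    _ d (p + u) a' b' c' α' β' γ' rfl hD' ha' hb' hc' h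
  exact ⟨v, fun i => subset_convexHull ℝ _ (Set.mem_image_of_mem toR (hv i)), hsumv⟩
end
end
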